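/- Let p > 3 be a prime, q = p^r with q ≢ 1 (mod 3), and let a ∈ F_q^×. Then Σ_{x,y,z ∈ F_q^×} ψ(z(1 + x³ + y³ − 3axy)) = (1/(q−1)) Σ_{l=0}^{q−2} G_{−l}³ G_{3l} T^{−3l}(−3a), as an identity of complex numbers (indices of G and exponents of T are taken modulo q−1). -/

import Mathlib

/-- Integer powers of a multiplicative character are computed pointwise on units. -/
lemma MulChar.zpow_apply_units {F : Type*} [Field F] (χ : MulChar F ℂ) (n : ℤ) (u : Fˣ) :
    (χ ^ n) (u : F) = χ (u : F) ^ n := by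
  rw [MulChar.zpow_apply_coe, ← MulChar.coe_toUnitHom, map_zpow, Units.val_zpow_eq_zpow_val,
    MulChar.coe_toUnitHom]

/-- The Gauss sum only sees the units of the field. -/
lemma gaussSum_eq_sum_units {F : Type*} [Field F] [Fintype F] [DecidableEq F]
    (χ : MulChar F ℂ) (ψ : AddChar F ℂ) :
    gaussSum χ ψ = ∑ u : Fˣ, χ u * ψ u := by
  have h : ∑ u : Fˣ, χ u * ψ u = ∑ v : {v : F // v ≠ 0}, χ v * ψ v :=
    Fintype.sum_equiv unitsEquivNeZero _ _ fun u ↦ rfl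
  rw [h, gaussSum, Fintype.sum_eq_add_sum_subtype_ne _ (0 : F), χ.map_zero, zero_mul, zero_add]

/-- A generator of the group of multiplicative characters takes the value `1` only at `1`. -/
lemma MulChar.eq_one_of_apply_eq_one_of_generator {F : Type*} [Field F] [Finite F]
    {T : MulChar F ℂ} (hT : ∀ χ : MulChar F ℂ, χ ∈ Subgroup.zpowers T) {u : Fˣ}
    (hu : T u = 1) : u = 1 := by
  by_contra hne
  obtain ⟨χ, hχ⟩ := MulChar.exists_apply_ne_one_of_hasEnoughRootsOfUnity F ℂ
    (a := (u : F)) (by simpa using hne)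
  obtain ⟨n, rfl⟩ := hT χ
  exact hχ (by simp only [MulChar.zpow_apply_units, hu, one_zpow])

/-- Orthogonality for the powers of the cube of a generator, when cubing is injective. -/
lemma MulChar.sum_pow_three_mul_apply {F : Type*} [Field F] [Fintype F] [DecidableEq F]
    {T : MulChar F ℂ} (hT : ∀ χ : MulChar F ℂ, χ ∈ Subgroup.zpowers T)
    (hc : Function.Injective fun u : Fˣ ↦ u ^ 3) (u : Fˣ) :
    ∑ l ∈ Finset.range (Fintype.card Fˣ), (T ^ (3 * (l : ℤ))) (u : F) =
      if u = 1 then (Fintype.card Fˣ : ℂ) else 0 := by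
  have hpow (l : ℕ) : (T ^ (3 * (l : ℤ))) (u : F) = T ((u ^ 3 : Fˣ) : F) ^ l := by
    rw [MulChar.zpow_apply_units, Units.val_pow_eq_pow_val, map_pow, zpow_mul, zpow_natCast]
    rfl
  simp only [hpow]
  split_ifs with h
  · simp [h]
  · have hne : T ((u ^ 3 : Fˣ) : F) ≠ 1 := fun h1 ↦
      h (hc (by simpa using MulChar.eq_one_of_apply_eq_one_of_generator hT h1))
    have h1 : T ((u ^ 3 : Fˣ) : F) ^ Fintype.card Fˣ = 1 := by
      rw [← map_pow, ← Units.val_pow_eq_pow_val, pow_card_eq_one]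
      simp
    rw [geom_sum_eq hne, h1, sub_self, zero_div]

/-- When cubing permutes the units, a Gauss sum can be summed over cubes. -/
lemma gaussSum_zpow_neg_eq_sum_cubes {F : Type*} [Field F] [Fintype F] [DecidableEq F]
    (T : MulChar F ℂ) (ψ : AddChar F ℂ) (hc : Function.Bijective fun u : Fˣ ↦ u ^ 3) (l : ℤ) :
    gaussSum (T ^ (-l)) ψ = ∑ x : Fˣ, (T ^ (-(3 * l))) (x : F) * ψ ((x : F) ^ 3) := by
  rw [gaussSum_eq_sum_units]
  refine (Fintype.sum_bijective _ hc _ _ fun x ↦ ?_).symm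
  have h : (T ^ (-(3 * l))) (x : F) = (T ^ (-l)) ((x : F) ^ 3) := by
    rw [map_pow, MulChar.zpow_apply_units, MulChar.zpow_apply_units, ← zpow_natCast, ← zpow_mul]
    congr 1
    push_cast
    ring
  rw [h, ← Units.val_pow_eq_pow_val]

/-- The Hessian exponential sum in symmetric form, when cubing permutes the units. -/
lemma sum_hessian_eq_sum_cubes {F : Type*} [Field F] [Fintype F] [DecidableEq F]
    (ψ : AddChar F ℂ) (hc : Function.Bijective fun u : Fˣ ↦ u ^ 3) (a : F) :
    (∑ x : Fˣ, ∑ y : Fˣ, ∑ z : Fˣ,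
        ψ ((z : F) * (1 + (x : F) ^ 3 + (y : F) ^ 3 - 3 * a * (x : F) * (y : F)))) =
      ∑ x : Fˣ, ∑ y : Fˣ, ∑ z : Fˣ,
        ψ ((x : F) ^ 3 + (y : F) ^ 3 + (z : F) ^ 3 - 3 * a * x * y * z) := by
  have hz (x y : Fˣ) : (∑ z : Fˣ,
      ψ ((z : F) * (1 + (x : F) ^ 3 + (y : F) ^ 3 - 3 * a * (x : F) * (y : F)))) =
      ∑ z : Fˣ, ψ ((z : F) ^ 3 * (1 + (x : F) ^ 3 + (y : F) ^ 3 - 3 * a * x * y)) :=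
    (Fintype.sum_bijective _ hc _ _ fun z ↦ by simp).symm
  simp only [hz]
  have hrot (f : Fˣ → Fˣ → Fˣ → ℂ) :
      ∑ x, ∑ y, ∑ z, f x y z = ∑ z, ∑ x, ∑ y, f x y z := by
    rw [Finset.sum_comm_cycle]
  refine (hrot _).trans (Eq.trans ?_ (hrot _).symm)
  refine Finset.sum_congr rfl fun z _ ↦ ?_
  refine Fintype.sum_equiv (Equiv.mulLeft z) _ _ fun x ↦ ?_
  refine Fintype.sum_equiv (Equiv.mulLeft z) _ _ fun y ↦ ?_
  simp only [Equiv.coe_mulLeft, Units.val_mul]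
  congr 1
  ring

/-- For `q ≢ 1 (mod 3)` and `a ∈ F_q^×`:
`Σ_{x,y,z ∈ F_q^×} ψ(z(1 + x³ + y³ − 3axy)) = (1/(q−1)) Σ_{l=0}^{q−2} G_{−l}³ G_{3l} T^{−3l}(−3a)`. -/
theorem sum_hessian_char_three_not_dvd
    (p r : ℕ) (hp : p.Prime) (hp3 : 3 < p) (hr : 0 < r)
    (F : Type) [Field F] [Fintype F] [DecidableEq F] (hcard : Fintype.card F = p ^ r)
    (ψ : AddChar F ℂ) (hψ : ψ ≠ 1)
    (T : MulChar F ℂ) (hT : ∀ χ : MulChar F ℂ, χ ∈ Subgroup.zpowers T)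
    (hq3 : p ^ r % 3 ≠ 1)
    (a : F) (ha : a ≠ 0) :
    (∑ x : Fˣ, ∑ y : Fˣ, ∑ z : Fˣ,
        ψ ((z : F) * (1 + (x : F) ^ 3 + (y : F) ^ 3 - 3 * a * (x : F) * (y : F))))
      = (1 / ((p : ℂ) ^ r - 1)) *
          ∑ l ∈ Finset.range (p ^ r - 1),
            (gaussSum (T ^ (-(l : ℤ))) ψ) ^ 3 * gaussSum (T ^ (3 * (l : ℤ))) ψ *
              (T ^ (-(3 * (l : ℤ)))) (-3 * a) := by
  have hcardU : Fintype.card Fˣ = p ^ r - 1 := by rw [Fintype.card_units, hcard]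
  have hcop : (Nat.card Fˣ).Coprime 3 := by
    rw [Nat.coprime_comm, Nat.Prime.coprime_iff_not_dvd Nat.prime_three, Nat.card_eq_fintype_card,
      hcardU]
    have h3p : ¬ 3 ∣ p ^ r := fun h ↦
      hp3.ne ((Nat.prime_dvd_prime_iff_eq Nat.prime_three hp).1 (Nat.prime_three.dvd_of_dvd_pow h))
    omega
  have hc : Function.Bijective fun u : Fˣ ↦ u ^ 3 := (powCoprime hcop).bijective
  have h3 : (3 : F) ≠ 0 := by
    intro h
    have hpF : (p : F) = 0 := by
      have h0 : ((p ^ r : ℕ) : F) = 0 := hcard ▸ Nat.cast_card_eq_zero F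
      exact eq_zero_of_pow_eq_zero (by exact_mod_cast h0)
    have hcop3 : IsCoprime (3 : ℤ) p := Nat.isCoprime_iff_coprime.2
      ((Nat.coprime_primes Nat.prime_three hp).2 hp3.ne)
    obtain ⟨m, n, hmn⟩ := hcop3
    have h1 := congrArg (Int.cast : ℤ → F) hmn
    push_cast at h1
    simp [h, hpF] at h1
  obtain ⟨b, hb⟩ : ∃ b : Fˣ, (b : F) = -3 * a :=
    ⟨Units.mk0 (-3 * a) (mul_ne_zero (neg_ne_zero.2 h3) ha), rfl⟩
  have hone : (1 : ℕ) ≤ p ^ r := Nat.one_le_pow _ _ hp.pos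
  have hq : (Fintype.card Fˣ : ℂ) = (p : ℂ) ^ r - 1 := by
    rw [hcardU, Nat.cast_sub hone]
    push_cast
    rfl
  have hq0 : (Fintype.card Fˣ : ℂ) ≠ 0 := Nat.cast_ne_zero.2 Fintype.card_ne_zero
  have hshift (l : ℤ) (v : Fˣ) : gaussSum (T ^ (3 * l)) ψ * (T ^ (-(3 * l))) (v : F) =
      ∑ s : Fˣ, (T ^ (3 * l)) (s : F) * ψ (v * s) := by
    have h := gaussSum_mulShift (T ^ (3 * l)) ψ v
    rw [← h, mul_right_comm, zpow_neg, ← MulChar.mul_apply, mul_inv_cancel,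
      MulChar.one_apply_coe, one_mul, gaussSum_eq_sum_units]
    rfl
  have hterm (l : ℤ) : gaussSum (T ^ (-l)) ψ ^ 3 * gaussSum (T ^ (3 * l)) ψ *
      (T ^ (-(3 * l))) (-3 * a) = ∑ x : Fˣ, ∑ y : Fˣ, ∑ z : Fˣ, ∑ s : Fˣ,
        (T ^ (3 * l)) (s : F) *
          ψ ((x : F) ^ 3 + (y : F) ^ 3 + (z : F) ^ 3 - 3 * a * x * y * z * s) := by
    have hs (x y z : Fˣ) : (∑ s : Fˣ, (T ^ (3 * l)) (s : F) *
          ψ ((x : F) ^ 3 + (y : F) ^ 3 + (z : F) ^ 3 - 3 * a * x * y * z * s)) =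
        (T ^ (-(3 * l))) (x : F) * ψ ((x : F) ^ 3) *
          ((T ^ (-(3 * l))) (y : F) * ψ ((y : F) ^ 3) *
            ((T ^ (-(3 * l))) (z : F) * ψ ((z : F) ^ 3) *
              (gaussSum (T ^ (3 * l)) ψ * (T ^ (-(3 * l))) (b : F)))) := by
      have h := congrArg (ψ ((x : F) ^ 3) * ψ ((y : F) ^ 3) * ψ ((z : F) ^ 3) * ·)
        (hshift l (b * x * y * z))
      simp only [Units.val_mul, map_mul, Finset.mul_sum] at h
      have hψ_add (s : Fˣ) :
          ψ ((x : F) ^ 3 + (y : F) ^ 3 + (z : F) ^ 3 - 3 * a * x * y * z * s) =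
            ψ ((x : F) ^ 3) * ψ ((y : F) ^ 3) * ψ ((z : F) ^ 3) *
              ψ (b * x * y * z * s) := by
        rw [← AddChar.map_add_eq_mul, ← AddChar.map_add_eq_mul, ← AddChar.map_add_eq_mul, hb]
        congr 1
        ring
      simp only [hψ_add, mul_left_comm ((T ^ (3 * l)) _)]
      rw [← h]
      ring
    simp only [hs, ← Finset.mul_sum, ← Finset.sum_mul, ← hb,
      gaussSum_zpow_neg_eq_sum_cubes T ψ hc l]
    ring
  rw [sum_hessian_eq_sum_cubes ψ hc a, ← hcardU, ← hq, one_div, eq_inv_mul_iff_mul_eq₀ hq0]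
  simp only [hterm]
  rw [Finset.mul_sum]
  refine Eq.trans ?_ Finset.sum_comm
  refine Finset.sum_congr rfl fun x _ ↦ ?_
  rw [Finset.mul_sum]
  refine Eq.trans ?_ Finset.sum_comm
  refine Finset.sum_congr rfl fun y _ ↦ ?_
  rw [Finset.mul_sum]
  refine Eq.trans ?_ Finset.sum_comm
  refine Finset.sum_congr rfl fun z _ ↦ ?_
  refine Eq.trans ?_ Finset.sum_comm
  simp only [← Finset.sum_mul, MulChar.sum_pow_three_mul_apply hT hc.injective]
  simp
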